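/- arXiv:1905.06928 — 3 statements merged into one kernel-verified Lean document; each statement's English description precedes it below -/
import Mathlib

section
/- For every n-qubit state ρ with n ≥ 3, the two-body sector length satisfies A_2(ρ) ≤ C(n,2), and the bound is attained by the pure product state |0⟩^{⊗n}. -/
open Matrix BigOperators Finset ComplexOrder

/-- The Pauli matrices, indexed by `Fin 4`: identity, X, Y, Z. -/
noncomputable def pauli : Fin 4 → Matrix (Fin 2) (Fin 2) ℂ
  | 0 => 1
  | 1 => !![0, 1; 1, 0]
  | 2 => !![0, -Complex.I; Complex.I, 0]
  | 3 => !![1, 0; 0, -1]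

/-- An `n`-qubit Pauli word: the tensor product of the Pauli matrices `pauli (w i)`,
realized as a matrix indexed by `Fin n → Fin 2`. -/
noncomputable def pWord {n : ℕ} (w : Fin n → Fin 4) :
    Matrix (Fin n → Fin 2) (Fin n → Fin 2) ℂ :=
  Matrix.of fun x y => ∏ i, pauli (w i) (x i) (y i)

/-- The weight of a Pauli word: the number of non-identity tensor factors. -/
def wt {n : ℕ} (w : Fin n → Fin 4) : ℕ :=
  (Finset.univ.filter fun i => w i ≠ 0).card

/-- The `k`-th sector length of an `n`-qubit matrix:
the sum of squared Pauli expectation values over Pauli words of weight `k`. -/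
noncomputable def sector (n k : ℕ) (ρ : Matrix (Fin n → Fin 2) (Fin n → Fin 2) ℂ) : ℝ :=
  ∑ w ∈ Finset.univ.filter fun w : Fin n → Fin 4 => wt w = k,
    ((pWord w * ρ).trace.re) ^ 2

/-- An `n`-qubit quantum state: positive semidefinite with unit trace. -/
def IsState {n : ℕ} (ρ : Matrix (Fin n → Fin 2) (Fin n → Fin 2) ℂ) : Prop :=
  ρ.PosSemidef ∧ ρ.trace = 1

/-- The outer product `|ψ⟩⟨ψ|` of a vector with itself. -/
noncomputable def outer {n : ℕ} (ψ : (Fin n → Fin 2) → ℂ) :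
    Matrix (Fin n → Fin 2) (Fin n → Fin 2) ℂ :=
  Matrix.of fun x y => ψ x * (starRingEnd ℂ) (ψ y)

/-- The pure product state `|0⟩^{⊗n}` as a vector. -/
noncomputable def allZero (n : ℕ) : (Fin n → Fin 2) → ℂ :=
  fun x => if x = fun _ => 0 then 1 else 0

noncomputable def G (U : Fin 2 → Fin 2 → Fin 2 → ℂ) (p q r : Fin 4) : ℂ :=
  ∑ a, ∑ b, ∑ c, ∑ a', ∑ b', ∑ c', pauli p a a' * pauli q b b' * pauli r c c' *
    ((starRingEnd ℂ) (U a b c) * U a' b' c')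

set_option maxRecDepth 100000 in
theorem pure3 (U : Fin 2 → Fin 2 → Fin 2 → ℂ) :
    ∑ p : Fin 3, ∑ q : Fin 3, ((G U p.succ q.succ 0).re ^ 2 + (G U p.succ 0 q.succ).re ^ 2 +
      (G U 0 p.succ q.succ).re ^ 2) = 3 * (∑ a, ∑ b, ∑ c, Complex.normSq (U a b c)) ^ 2 := by
  have e0 : (0 : Fin 3).succ = 1 := rfl
  have e1 : (1 : Fin 3).succ = 2 := rfl
  have e2 : (2 : Fin 3).succ = 3 := rfl
  simp only [Fin.sum_univ_three, e0, e1, e2]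
  simp only [G, Fin.sum_univ_two, pauli, Matrix.one_apply, Matrix.of_apply, Matrix.cons_val', Matrix.cons_val_zero,
    Matrix.cons_val_one, Matrix.cons_val_fin_one, zero_mul, mul_zero, add_zero, zero_add, one_mul, mul_one,
    if_true, Fin.isValue, zero_ne_one, one_ne_zero, if_false, neg_mul, mul_neg, neg_neg,
    Complex.add_re, Complex.neg_re, Complex.mul_re, Complex.mul_im, 
    Complex.conj_re, Complex.conj_im, Complex.I_re, Complex.I_im, Complex.normSq_apply, sub_zero, zero_sub, Complex.zero_re]
  ring1


theorem minkowski {ι κ : Type*} [Fintype κ] (s : Finset ι) (f : κ → ι → ℝ) (N : κ → ℝ)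
    (hN : ∀ k, 0 ≤ N k) (h : ∀ k, ∑ w ∈ s, f k w ^ 2 = 3 * N k ^ 2) :
    ∑ w ∈ s, (∑ k, f k w) ^ 2 ≤ 3 * (∑ k, N k) ^ 2 := by
  have key : ∀ k l, ∑ w ∈ s, f k w * f l w ≤ 3 * (N k * N l) := by
    intro k l
    have := Finset.sum_mul_sq_le_sq_mul_sq s (f k) (f l)
    rw [h, h] at this
    have h2 := mul_nonneg (hN k) (hN l)
    refine le_of_sq_le_sq ?_ (by positivity)
    nlinarith
  calc ∑ w ∈ s, (∑ k, f k w) ^ 2 = ∑ k, ∑ l, ∑ w ∈ s, f k w * f l w := by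
        simp_rw [sq, Finset.sum_mul_sum]
        rw [Finset.sum_comm]
        refine Finset.sum_congr rfl fun k _ => ?_
        rw [Finset.sum_comm]
    _ ≤ ∑ k, ∑ l, 3 * (N k * N l) := Finset.sum_le_sum fun k _ => Finset.sum_le_sum fun l _ => key k l
    _ = _ := by rw [sq, Finset.sum_mul_sum]; simp_rw [Finset.mul_sum]

open scoped MatrixOrder in
theorem posdec {n : ℕ} (ρ : Matrix (Fin n → Fin 2) (Fin n → Fin 2) ℂ) (h : ρ.PosSemidef) :
    ∃ B : Matrix (Fin n → Fin 2) (Fin n → Fin 2) ℂ, ρ = Bᴴ * B := by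
  exact CStarAlgebra.nonneg_iff_eq_star_mul_self.mp h.nonneg

theorem sum3 {A : Type*} [Fintype A] {M : Type*} [AddCommMonoid M] (F : (Fin 3 → A) → M) :
    ∑ f, F f = ∑ a, ∑ b, ∑ c, F ![a, b, c] := by
  rw [← Equiv.sum_comp (Fin.consEquiv (fun _ => A)), Fintype.sum_prod_type]
  refine Finset.sum_congr rfl fun a _ => ?_
  rw [← Equiv.sum_comp (Fin.consEquiv (fun _ => A)), Fintype.sum_prod_type]
  refine Finset.sum_congr rfl fun b _ => ?_
  rw [← Equiv.sum_comp (Fin.consEquiv (fun _ => A)), Fintype.sum_prod_type]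
  refine Finset.sum_congr rfl fun c _ => ?_
  rw [Fintype.sum_unique]
  congr 1

theorem wt_sum3 (F : (Fin 3 → Fin 4) → ℝ) :
    ∑ v ∈ Finset.univ.filter (fun v : Fin 3 → Fin 4 => wt v = 2), F v =
    ∑ p : Fin 3, ∑ q : Fin 3, (F ![p.succ, q.succ, 0] + F ![p.succ, 0, q.succ] + F ![0, p.succ, q.succ]) := by
  have hw : ∀ a b c : Fin 4, wt ![a, b, c] = (if a = 0 then 0 else 1) + (if b = 0 then 0 else 1) + (if c = 0 then 0 else 1) := by
    decide
  rw [Finset.sum_filter, sum3]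
  simp only [hw]
  simp only [Fin.sum_univ_succ (n := 3), Fin.succ_ne_zero, if_true, if_false]
  simp [Finset.sum_add_distrib]
  ring

theorem pureQ (u : (Fin 3 → Fin 2) → ℂ) :
    ∑ v ∈ Finset.univ.filter (fun v : Fin 3 → Fin 4 => wt v = 2),
      (∑ s, ∑ t, pWord v s t * ((starRingEnd ℂ) (u s) * u t)).re ^ 2 =
    3 * (∑ s, Complex.normSq (u s)) ^ 2 := by
  have hG : ∀ p q r, (∑ s, ∑ t, pWord ![p, q, r] s t * ((starRingEnd ℂ) (u s) * u t)) =
      G (fun a b c => u ![a, b, c]) p q r := by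
    intro p q r
    rw [sum3]
    simp_rw [sum3]
    simp [G, pWord, Fin.prod_univ_three]
  rw [wt_sum3]
  simp_rw [hG]
  rw [pure3, sum3]

theorem pWord_sum {n : ℕ} {R : Type*} [Fintype R] [DecidableEq R] (σ : Fin 3 ⊕ R ≃ Fin n) (v : Fin 3 → Fin 4)
    (s t : Fin 3 → Fin 2) (z z' : R → Fin 2) :
    pWord (Sum.elim v (fun _ => 0) ∘ σ.symm) (Sum.elim s z ∘ σ.symm) (Sum.elim t z' ∘ σ.symm) =
      pWord v s t * if z = z' then 1 else 0 := by
  simp only [pWord, Matrix.of_apply]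
  rw [← Equiv.prod_comp σ]
  simp only [Function.comp, Equiv.symm_apply_apply, Fintype.prod_sum_type, Sum.elim_inl, Sum.elim_inr]
  congr 1
  simp only [pauli, Matrix.one_apply]
  rw [Finset.prod_ite_zero]
  simp [funext_iff]

theorem sum_split {n : ℕ} {R : Type*} [Fintype R] [DecidableEq R] (σ : Fin 3 ⊕ R ≃ Fin n) {M : Type*} [AddCommMonoid M]
   (F : (Fin n → Fin 2) → M) : ∑ x, F x = ∑ s : Fin 3 → Fin 2, ∑ z : R → Fin 2, F (Sum.elim s z ∘ σ.symm) := by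
  rw [← Fintype.sum_prod_type', ← Equiv.sum_comp ((Equiv.sumArrowEquivProdArrow _ _ _).symm.trans (Equiv.arrowCongr σ (Equiv.refl _)))]
  rfl

theorem trace_split {n : ℕ} {R : Type*} [Fintype R] [DecidableEq R] (σ : Fin 3 ⊕ R ≃ Fin n) (v : Fin 3 → Fin 4)
    (B : Matrix (Fin n → Fin 2) (Fin n → Fin 2) ℂ) :
    (pWord (Sum.elim v (fun _ => 0) ∘ σ.symm) * (Bᴴ * B)).trace =
      ∑ k : (Fin n → Fin 2) × (R → Fin 2), ∑ s, ∑ t, pWord v s t *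
        ((starRingEnd ℂ) ((starRingEnd ℂ) (B k.1 (Sum.elim s k.2 ∘ σ.symm))) *
          (starRingEnd ℂ) (B k.1 (Sum.elim t k.2 ∘ σ.symm))) := by
  have h1 : (pWord (Sum.elim v (fun _ => 0) ∘ σ.symm) * (Bᴴ * B)).trace =
      ∑ k, ∑ x, ∑ y, pWord (Sum.elim v (fun _ => 0) ∘ σ.symm) x y * (star (B k y) * B k x) := by
    simp only [Matrix.trace, Matrix.diag, Matrix.mul_apply, Matrix.conjTranspose_apply, Finset.mul_sum]
    rw [Finset.sum_comm' (t' := Finset.univ) (s' := fun _ => Finset.univ) (by simp)]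
    rw [Finset.sum_comm]
    conv_rhs => rw [Finset.sum_comm]
    refine Finset.sum_congr rfl fun x _ => ?_
    rw [Finset.sum_comm]
  rw [h1, Fintype.sum_prod_type]
  refine Finset.sum_congr rfl fun k _ => ?_
  rw [sum_split σ, Finset.sum_comm]
  refine Finset.sum_congr rfl fun z _ => ?_
  refine Finset.sum_congr rfl fun s _ => ?_
  rw [sum_split σ]
  refine Finset.sum_congr rfl fun t _ => ?_
  rw [Finset.sum_eq_single z]
  · rw [pWord_sum]; simp [mul_comm]
  · intro z' _ hz
    rw [pWord_sum, if_neg (Ne.symm hz)]; simp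
  · simp

theorem trace1_split {n : ℕ} {R : Type*} [Fintype R] [DecidableEq R] (σ : Fin 3 ⊕ R ≃ Fin n) 
    (B : Matrix (Fin n → Fin 2) (Fin n → Fin 2) ℂ) (h : (Bᴴ * B).trace = 1) :
      ∑ k : (Fin n → Fin 2) × (R → Fin 2), ∑ s, Complex.normSq ((starRingEnd ℂ) (B k.1 (Sum.elim s k.2 ∘ σ.symm))) = 1 := by
  simp only [Matrix.trace, Matrix.diag, Matrix.mul_apply, Matrix.conjTranspose_apply] at h
  rw [Finset.sum_comm] at h
  rw [Fintype.sum_prod_type]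
  have := congrArg Complex.re h
  rw [Complex.one_re] at this
  rw [← this, Complex.re_sum]
  refine Finset.sum_congr rfl fun k _ => ?_
  rw [sum_split σ, Finset.sum_comm, Complex.re_sum]
  refine Finset.sum_congr rfl fun k _ => ?_
  rw [Complex.re_sum]
  refine Finset.sum_congr rfl fun k _ => ?_
  simp [Complex.normSq_apply]

theorem pow_count {n : ℕ} (T : Finset (Fin n)) (hT : T.card = 2) :
    ((Finset.powersetCard 3 (Finset.univ : Finset (Fin n))).filter (fun S => T ⊆ S)).card = n - 2 := by
  have : ((Finset.powersetCard 3 (Finset.univ : Finset (Fin n))).filter (fun S => T ⊆ S)) = Tᶜ.image (fun x => insert x T) := by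
    ext S
    simp only [Finset.mem_filter, Finset.mem_powersetCard, Finset.subset_univ, true_and, Finset.mem_image, Finset.mem_compl]
    constructor
    · rintro ⟨h, hs⟩
      obtain ⟨x, hx⟩ := Finset.card_eq_one.mp (show (S \ T).card = 1 by rw [Finset.card_sdiff_of_subset hs]; omega)
      have hx' : x ∈ S \ T := by rw [hx]; simp
      refine ⟨x, (Finset.mem_sdiff.mp hx').2, ?_⟩
      rw [Finset.insert_eq, ← hx, Finset.sdiff_union_of_subset hs]
    · rintro ⟨x, hx, rfl⟩
      exact ⟨by rw [Finset.card_insert_of_notMem hx, hT], Finset.subset_insert _ _⟩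
  rw [this, Finset.card_image_of_injOn, Finset.card_compl, hT, Fintype.card_fin]
  intro x hx y hy hxy
  simp only [Finset.coe_compl, Set.mem_compl_iff, Finset.mem_coe] at hx hy
  have : x ∈ insert y T := by rw [← show insert x T = insert y T from hxy]; simp
  simpa [hx] using this

theorem zero_case (n : ℕ) : sector n 2 (outer (allZero n)) = n.choose 2 := by
  have h1 : ∀ w : Fin n → Fin 4, ((pWord w * outer (allZero n)).trace.re) ^ 2 = if ∀ i, w i = 0 ∨ w i = 3 then 1 else 0 := by
    intro w
    have : (pWord w * outer (allZero n)).trace = ∏ i, pauli (w i) 0 0 := by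
      simp [Matrix.trace, Matrix.mul_apply, outer, allZero, pWord, apply_ite]
    rw [this]
    have h2 : ∀ a : Fin 4, pauli a 0 0 = if a = 0 ∨ a = 3 then 1 else 0 := by
      intro a; fin_cases a <;> simp [pauli]
    simp_rw [h2]
    rw [Finset.prod_ite_zero]
    simp only [Finset.mem_univ, true_implies, Finset.prod_const_one]
    split_ifs <;> simp
  unfold sector
  simp_rw [h1]
  rw [Finset.sum_boole, Finset.filter_filter]
  have : (Finset.powersetCard 2 (Finset.univ : Finset (Fin n))).card = n.choose 2 := by simp
  rw [← this]
  congr 1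
  refine Finset.card_bij' (fun w _ => Finset.univ.filter fun i => w i ≠ 0) (fun S _ i => if i ∈ S then 3 else 0) ?_ ?_ ?_ ?_
  · intro w hw
    simp only [Finset.mem_filter, Finset.mem_univ, true_and] at hw
    simp [Finset.mem_powersetCard, ← hw.1, wt]
  · intro S hS
    simp only [Finset.mem_powersetCard, Finset.subset_univ, true_and] at hS
    rw [Finset.mem_filter]
    refine ⟨Finset.mem_univ _, ?_, ?_⟩
    unfold wt
    · rw [← hS]; congr 1; ext i; simp
    · intro i; by_cases h : i ∈ S <;> simp [h]
  · intro w hw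
    simp only [Finset.mem_filter, Finset.mem_univ, true_and] at hw
    funext i
    rcases hw.2 i with h | h <;> simp [h]
  · intro S hS
    ext i; simp

theorem wt_ext {n : ℕ} {R : Type*} [Fintype R] (σ : Fin 3 ⊕ R ≃ Fin n) (v : Fin 3 → Fin 4) :
    wt (Sum.elim v (fun _ => 0) ∘ σ.symm) = wt v := by
  unfold wt
  rw [Finset.card_filter, Finset.card_filter, ← Equiv.sum_comp σ]
  simp [Fintype.sum_sum_type]
  rfl

theorem triple_bound {n : ℕ} (ρ : Matrix (Fin n → Fin 2) (Fin n → Fin 2) ℂ) (h : IsState ρ)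
    (S : Finset (Fin n)) (hS : S.card = 3) :
    ∑ w ∈ Finset.univ.filter (fun w : Fin n → Fin 4 => wt w = 2 ∧ (Finset.univ.filter fun i => w i ≠ 0) ⊆ S),
      ((pWord w * ρ).trace.re) ^ 2 ≤ 3 := by
  obtain ⟨B, rfl⟩ := posdec ρ h.1
  let σ : Fin 3 ⊕ {i // ¬ i ∈ S} ≃ Fin n :=
    (Equiv.sumCongr (S.equivFinOfCardEq hS).symm (Equiv.refl _)).trans (Equiv.sumCompl (· ∈ S))
  have hσr : ∀ r, σ (Sum.inr r) ∉ S := fun r => r.2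
  have hσl : ∀ a, σ (Sum.inl a) ∈ S := fun a => ((S.equivFinOfCardEq hS).symm a).2
  have hre : ∑ w ∈ Finset.univ.filter (fun w : Fin n → Fin 4 => wt w = 2 ∧ (Finset.univ.filter fun i => w i ≠ 0) ⊆ S),
      ((pWord w * (Bᴴ * B)).trace.re) ^ 2 =
      ∑ v ∈ Finset.univ.filter (fun v : Fin 3 → Fin 4 => wt v = 2),
        ((pWord (Sum.elim v (fun _ => 0) ∘ σ.symm) * (Bᴴ * B)).trace.re) ^ 2 := by
    have hinv : ∀ w : Fin n → Fin 4, (Finset.univ.filter fun i => w i ≠ 0) ⊆ S →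
        Sum.elim (w ∘ σ ∘ Sum.inl) (fun _ => 0) ∘ σ.symm = w := by
      intro w hw
      funext i
      obtain ⟨j, rfl⟩ := σ.surjective i
      rcases j with a | r
      · simp
      · simp only [Function.comp, Equiv.symm_apply_apply, Sum.elim_inr]
        by_contra hne
        exact hσr r (hw (by simpa using Ne.symm hne))
    refine Finset.sum_bij' (fun w _ => w ∘ σ ∘ Sum.inl) (fun v _ => Sum.elim v (fun _ => 0) ∘ σ.symm) ?_ ?_ ?_ ?_ ?_
    · intro w hw
      rw [Finset.mem_filter] at hw ⊢
      refine ⟨Finset.mem_univ _, ?_⟩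
      rw [← wt_ext σ, hinv w hw.2.2]; exact hw.2.1
    · intro v hv
      rw [Finset.mem_filter] at hv ⊢
      refine ⟨Finset.mem_univ _, ?_, ?_⟩
      · rw [wt_ext]; exact hv.2
      · intro i hi
        obtain ⟨j, rfl⟩ := σ.surjective i
        rcases j with a | r
        · exact hσl a
        · simp at hi
    · intro w hw
      rw [Finset.mem_filter] at hw
      exact hinv w hw.2.2
    · intro v hv
      funext a; simp
    · intro w hw
      rw [Finset.mem_filter] at hw
      rw [hinv w hw.2.2]
  rw [hre]
  simp_rw [trace_split, Complex.re_sum (s := (Finset.univ : Finset ((Fin n → Fin 2) × ({i // ¬ i ∈ S} → Fin 2))))]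
  have := minkowski (Finset.univ.filter (fun v : Fin 3 → Fin 4 => wt v = 2))
    (fun (k : (Fin n → Fin 2) × ({i // ¬ i ∈ S} → Fin 2)) v => (∑ s, ∑ t, pWord v s t *
        ((starRingEnd ℂ) ((starRingEnd ℂ) (B k.1 (Sum.elim s k.2 ∘ σ.symm))) *
          (starRingEnd ℂ) (B k.1 (Sum.elim t k.2 ∘ σ.symm)))).re)
    (fun k => ∑ s, Complex.normSq ((starRingEnd ℂ) (B k.1 (Sum.elim s k.2 ∘ σ.symm))))
    (fun k => Finset.sum_nonneg fun s _ => Complex.normSq_nonneg _)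
    (fun k => pureQ (fun s => (starRingEnd ℂ) (B k.1 (Sum.elim s k.2 ∘ σ.symm))))
  rw [trace1_split σ B h.2] at this
  refine this.trans (by norm_num)

theorem upper {n : ℕ} (hn : 3 ≤ n) (ρ : Matrix (Fin n → Fin 2) (Fin n → Fin 2) ℂ) (h : IsState ρ) :
    sector n 2 ρ ≤ n.choose 2 := by
  have h1 : ((n - 2 : ℕ) : ℝ) * sector n 2 ρ ≤ (n.choose 3 : ℕ) * 3 := by
    have e : ((n - 2 : ℕ) : ℝ) * sector n 2 ρ =
        ∑ S ∈ Finset.powersetCard 3 (Finset.univ : Finset (Fin n)),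
          ∑ w ∈ Finset.univ.filter (fun w : Fin n → Fin 4 => wt w = 2 ∧ (Finset.univ.filter fun i => w i ≠ 0) ⊆ S),
            ((pWord w * ρ).trace.re) ^ 2 := by
      simp_rw [← Finset.filter_filter]
      simp_rw [Finset.sum_filter (fun w : Fin n → Fin 4 => (Finset.univ.filter fun i => w i ≠ 0) ⊆ _)]
      rw [Finset.sum_comm, sector, Finset.mul_sum]
      refine Finset.sum_congr rfl fun w hw => ?_
      rw [Finset.mem_filter] at hw
      rw [← Finset.sum_filter, Finset.sum_const, pow_count _ hw.2, nsmul_eq_mul]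
    rw [e]
    calc _ ≤ ∑ S ∈ Finset.powersetCard 3 (Finset.univ : Finset (Fin n)), (3 : ℝ) :=
          Finset.sum_le_sum fun S hS => triple_bound ρ h S (Finset.mem_powersetCard.mp hS).2
      _ = _ := by simp
  have h2 : n.choose 3 * 3 = n.choose 2 * (n - 2) := Nat.choose_succ_right_eq n 2
  have h3 : ((n.choose 3 : ℕ) : ℝ) * 3 = n.choose 2 * (n - 2 : ℕ) := by exact_mod_cast h2
  have h4 : (0 : ℝ) < (n - 2 : ℕ) := by exact_mod_cast (by omega)
  rw [h3, mul_comm] at h1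
  exact le_of_mul_le_mul_right h1 h4

/-- Every `n`-qubit state with `n ≥ 3` satisfies `A₂(ρ) ≤ C(n,2)`, and the
bound is attained by the pure product state `|0⟩^{⊗n}`. -/
theorem sector_two_bound (n : ℕ) (hn : 3 ≤ n) :
    (∀ ρ : Matrix (Fin n → Fin 2) (Fin n → Fin 2) ℂ,
      IsState ρ → sector n 2 ρ ≤ n.choose 2) ∧
    sector n 2 (outer (allZero n)) = n.choose 2 := by
  exact ⟨fun ρ h => upper hn ρ h, zero_case n⟩
end

section
/- For any n-qubit density matrix ρ with n odd, the full-body sector length satisfies A_n(ρ) ≤ 2^{n−1}. -/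
open Matrix BigOperators Finset ComplexOrder

lemma aux_trace_mul_nonneg {m : Type*} [Fintype m] [DecidableEq m] {A B : Matrix m m ℂ}
    (hA : A.PosSemidef) (hB : B.PosSemidef) : 0 ≤ (A * B).trace := by
  open scoped MatrixOrder in
  obtain ⟨C, rfl⟩ := CStarAlgebra.nonneg_iff_eq_star_mul_self.mp hA.nonneg
  rw [Matrix.mul_assoc, Matrix.trace_mul_comm]
  exact (hB.mul_mul_conjTranspose_same C).trace_nonneg

lemma aux_trace_sq {m : Type*} [Fintype m] [DecidableEq m] {A : Matrix m m ℂ}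
    (hA : A.PosSemidef) (h1 : A.trace = 1) : (A * A).trace ≤ 1 := by
  have h2 : (1 : ℂ) = A.trace * A.trace := by rw [h1, one_mul]
  rw [h2]
  simp only [Matrix.trace, Matrix.diag_apply, Matrix.mul_apply, Finset.sum_mul_sum]
  refine Finset.sum_le_sum fun x _ => Finset.sum_le_sum fun y _ => ?_
  have h := (hA.submatrix ![x, y]).det_nonneg
  rw [Matrix.det_fin_two] at h
  simpa using h

lemma aux_key {n : ℕ} (ρ : Matrix (Fin n → Fin 2) (Fin n → Fin 2) ℂ) (c : Fin 4 → ℂ) :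
    ∑ w : Fin n → Fin 4, (∏ i, c (w i)) * ((pWord w * ρ).trace * (pWord w * ρ).trace)
      = ∑ x, ∑ y, ∑ x', ∑ y', ρ y x * ρ y' x' *
        ∏ i, ∑ a, c a * (pauli a (x i) (y i) * pauli a (x' i) (y' i)) := by
  simp only [Finset.prod_univ_sum, Fintype.piFinset_univ, Finset.mul_sum, Finset.prod_mul_distrib]
  simp only [Matrix.trace, Matrix.diag_apply, Matrix.mul_apply, pWord, Matrix.of_apply,
    Finset.sum_mul, Finset.mul_sum]
  simp only [← Fintype.sum_prod_type']
  refine Fintype.sum_equiv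
    (⟨fun p => (p.2.2.2.1, p.2.2.2.2, p.2.1, p.2.2.1, p.1),
      fun q => (q.2.2.2.2, q.2.2.1, q.2.2.2.1, q.1, q.2.1), fun _ => rfl, fun _ => rfl⟩) _ _ ?_
  intro p
  simp
  ring

lemma aux_plus (x y x' y' : Fin 2) :
    ∑ a, (pauli a x y * pauli a x' y') =
      2 * ((1 : Matrix (Fin 2) (Fin 2) ℂ) x y' * (1 : Matrix (Fin 2) (Fin 2) ℂ) x' y) := by
  fin_cases x <;> fin_cases y <;> fin_cases x' <;> fin_cases y' <;>
    simp [Fin.sum_univ_four, pauli] <;> norm_num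

/-- signs -/
def auxC (a : Fin 4) : ℂ := if a ≠ 0 then -1 else 1

def auxE : Matrix (Fin 2) (Fin 2) ℂ := !![0, 1; -1, 0]

lemma aux_minus (x y x' y' : Fin 2) :
    ∑ a, auxC a * (pauli a x y * pauli a x' y') = 2 * (auxE x x' * auxE y y') := by
  fin_cases x <;> fin_cases y <;> fin_cases x' <;> fin_cases y' <;>
    simp [Fin.sum_univ_four, pauli, auxC, auxE] <;> norm_num

lemma aux_one {n : ℕ} (x y : Fin n → Fin 2) :
    ∏ i, (1 : Matrix (Fin 2) (Fin 2) ℂ) (x i) (y i) =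
      (1 : Matrix (Fin n → Fin 2) (Fin n → Fin 2) ℂ) x y := by
  simp only [Matrix.one_apply]
  by_cases h : x = y
  · simp [h]
  · obtain ⟨i, hi⟩ := Function.ne_iff.mp h
    rw [if_neg h]
    exact Finset.prod_eq_zero (Finset.mem_univ i) (if_neg hi)

def auxEE (n : ℕ) : Matrix (Fin n → Fin 2) (Fin n → Fin 2) ℂ :=
  Matrix.of fun x y => ∏ i, auxE (x i) (y i)

lemma aux_sum_plus {n : ℕ} (ρ : Matrix (Fin n → Fin 2) (Fin n → Fin 2) ℂ) :
    ∑ w : Fin n → Fin 4, ((pWord w * ρ).trace * (pWord w * ρ).trace)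
      = 2 ^ n * (ρ * ρ).trace := by
  have h := aux_key ρ (fun _ => 1)
  simp only [one_mul, aux_plus, Finset.prod_mul_distrib, aux_one, Finset.prod_const, Finset.card_univ,
    Fintype.card_fin, one_pow, one_mul] at h
  rw [h]
  simp only [Matrix.trace, Matrix.diag_apply, Matrix.mul_apply, Finset.mul_sum]
  refine Finset.sum_congr rfl fun x _ => Finset.sum_congr rfl fun y _ => ?_
  rw [Finset.sum_eq_single y (fun b _ hb => by simp [Matrix.one_apply_ne hb]) (by simp),
    Finset.sum_eq_single x (fun b _ hb => by simp [Matrix.one_apply_ne hb.symm]) (by simp)]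
  simp only [Matrix.one_apply_eq]
  ring

lemma aux_EE_real {n : ℕ} : (auxEE n)ᴴ = (auxEE n)ᵀ := by
  ext x y
  simp only [Matrix.conjTranspose_apply, Matrix.transpose_apply, auxEE, Matrix.of_apply, star_prod]
  refine Finset.prod_congr rfl fun i _ => ?_
  generalize y i = a
  generalize x i = b
  fin_cases a <;> fin_cases b <;> simp [auxE]

lemma aux_sum_minus {n : ℕ} (ρ : Matrix (Fin n → Fin 2) (Fin n → Fin 2) ℂ) :
    ∑ w : Fin n → Fin 4, (∏ i, auxC (w i)) * ((pWord w * ρ).trace * (pWord w * ρ).trace)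
      = 2 ^ n * (ρ * (auxEE n * ρᵀ * (auxEE n)ᴴ)).trace := by
  rw [aux_key, aux_EE_real]
  simp only [aux_minus, Finset.prod_mul_distrib, Finset.prod_const, Finset.card_univ,
    Fintype.card_fin]
  simp only [Matrix.trace, Matrix.diag_apply, Matrix.mul_apply, Finset.mul_sum, Finset.sum_mul,
    Matrix.transpose_apply]
  simp only [← Fintype.sum_prod_type']
  refine Fintype.sum_equiv
    (⟨fun p => (p.2.1, p.1, p.2.2.2, p.2.2.1),
      fun p => (p.2.1, p.1, p.2.2.2, p.2.2.1), fun _ => rfl, fun _ => rfl⟩) _ _ ?_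
  intro p
  simp [auxEE]
  ring

lemma aux_herm {n : ℕ} (w : Fin n → Fin 4) : (pWord w)ᴴ = pWord w := by
  ext x y
  simp only [Matrix.conjTranspose_apply, pWord, Matrix.of_apply, star_prod]
  refine Finset.prod_congr rfl fun i _ => ?_
  generalize y i = a
  generalize x i = b
  generalize w i = k
  fin_cases k <;> fin_cases a <;> fin_cases b <;> simp [pauli]

lemma aux_real {n : ℕ} (w : Fin n → Fin 4) (ρ : Matrix (Fin n → Fin 2) (Fin n → Fin 2) ℂ)
    (h : ρᴴ = ρ) : (pWord w * ρ).trace * (pWord w * ρ).trace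
      = (((pWord w * ρ).trace.re ^ 2 : ℝ) : ℂ) := by
  have h1 : star (pWord w * ρ).trace = (pWord w * ρ).trace := by
    rw [← Matrix.trace_conjTranspose, Matrix.conjTranspose_mul, aux_herm, h, Matrix.trace_mul_comm]
  have h2 := Complex.conj_eq_iff_re.mp h1
  push_cast
  rw [h2, sq]

lemma aux_sign {n : ℕ} (w : Fin n → Fin 4) : ∏ i, auxC (w i) = (((-1) ^ wt w : ℝ) : ℂ) := by
  simp [auxC, Finset.prod_ite, wt]

/-- For any `n`-qubit state with `n` odd, the full-body sector length
satisfies `A_n(ρ) ≤ 2^{n−1}`. -/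
theorem full_sector_odd_bound (n : ℕ) (hn : Odd n)
    (ρ : Matrix (Fin n → Fin 2) (Fin n → Fin 2) ℂ) (hρ : IsState ρ) :
    sector n n ρ ≤ 2 ^ (n - 1) := by
  obtain ⟨hp, h1⟩ := hρ
  have hP := aux_sum_plus ρ
  have hM := aux_sum_minus ρ
  simp only [aux_real _ ρ hp.1, aux_sign] at hP hM
  have h3 := aux_trace_sq hp h1
  have h4 := aux_trace_mul_nonneg hp (hp.transpose.mul_mul_conjTranspose_same (auxEE n))
  have hP' := congrArg Complex.re hP
  have hM' := congrArg Complex.re hM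
  have e : (2 : ℂ) ^ n = (((2 : ℝ) ^ n : ℝ) : ℂ) := by push_cast; rfl
  rw [e, Complex.re_ofReal_mul] at hP' hM'
  norm_cast at hP' hM'
  have h3' := (Complex.le_def.mp h3).1
  have h4' := (Complex.le_def.mp h4).1
  simp only [Complex.one_re, Complex.zero_re] at h3' h4'
  have h2n : (0 : ℝ) < 2 ^ n := by positivity
  have hA : 2 * sector n n ρ ≤ ∑ w : Fin n → Fin 4, ((pWord w * ρ).trace.re ^ 2
      - (-1) ^ wt w * (pWord w * ρ).trace.re ^ 2) := by
    unfold sector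
    rw [Finset.mul_sum, Finset.sum_filter]
    refine Finset.sum_le_sum fun w _ => ?_
    split_ifs with hw
    · rw [hw, hn.neg_one_pow]; linarith
    · rcases neg_one_pow_eq_or ℝ (wt w) with h | h <;> rw [h] <;>
        nlinarith [sq_nonneg (pWord w * ρ).trace.re]
  rw [Finset.sum_sub_distrib] at hA
  push_cast at hP' hM'
  have hn1 : (2 : ℝ) ^ n = 2 * 2 ^ (n - 1) := by
    rw [← pow_succ', Nat.sub_add_cancel hn.pos]
  have h5 := mul_le_mul_of_nonneg_left h3' h2n.le
  have h6 := mul_nonneg h2n.le h4'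
  linarith
end

section
/- Every biseparable three-qubit state ρ satisfies A_3(ρ) ≤ 3; since the GHZ state has A_3 = 4, three-qubit states with A_3 > 3 are genuinely multipartite entangled. -/
open Matrix BigOperators Finset ComplexOrder

/-- Embed a single-qubit matrix `A` on qubit `j` and a two-qubit matrix `B` on the
remaining two qubits (in increasing order), forming a three-qubit matrix `A ⊗_j B`. -/
noncomputable def emb3 (j : Fin 3) (A : Matrix (Fin 2) (Fin 2) ℂ)
    (B : Matrix (Fin 2 → Fin 2) (Fin 2 → Fin 2) ℂ) :
    Matrix (Fin 3 → Fin 2) (Fin 3 → Fin 2) ℂ :=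
  Matrix.of fun x y =>
    A (x j) (y j) * B (fun t => x (j.succAbove t)) (fun t => y (j.succAbove t))

/-- A three-qubit state is biseparable iff it is a convex combination of states that are
product across some bipartition `{i}|{j,k}`. -/
def Biseparable3 (ρ : Matrix (Fin 3 → Fin 2) (Fin 3 → Fin 2) ℂ) : Prop :=
  ∃ (m : ℕ) (p : Fin m → ℝ) (j : Fin m → Fin 3)
    (a : Fin m → Matrix (Fin 2) (Fin 2) ℂ)
    (b : Fin m → Matrix (Fin 2 → Fin 2) (Fin 2 → Fin 2) ℂ),
    (∀ i, 0 ≤ p i) ∧ (∑ i, p i = 1) ∧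
    (∀ i, (a i).PosSemidef ∧ (a i).trace = 1) ∧
    (∀ i, (b i).PosSemidef ∧ (b i).trace = 1) ∧
    ρ = ∑ i, (p i : ℂ) • emb3 (j i) (a i) (b i)

/-- The three-qubit GHZ state vector `(|000⟩ + |111⟩)/√2`. -/
noncomputable def ghzVec : (Fin 3 → Fin 2) → ℂ := fun x =>
  if x = (fun _ => 0) then (Real.sqrt 2 : ℂ)⁻¹
  else if x = (fun _ => 1) then (Real.sqrt 2 : ℂ)⁻¹ else 0

lemma minor_le {n : Type*} [Fintype n] [DecidableEq n] {ρ : Matrix n n ℂ} (h : ρ.PosSemidef)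
    (a b : n) : Complex.normSq (ρ a b) ≤ (ρ a a).re * (ρ b b).re := by
  have h1 := (h.submatrix ![a, b]).det_nonneg
  rw [Matrix.det_fin_two] at h1
  simp only [Matrix.submatrix_apply, Matrix.cons_val_zero, Matrix.cons_val_one] at h1
  have h2 : ρ b a = star (ρ a b) := (h.isHermitian.apply b a).symm
  have ha : (ρ a a).im = 0 := Complex.conj_eq_iff_im.mp (h.isHermitian.apply a a)
  rw [h2] at h1
  have := (Complex.le_def.mp h1).1
  simp [ha, Complex.normSq_apply] at this ⊢
  linarith

lemma parseval {n ι : Type*} [Fintype n] [DecidableEq n] [Fintype ι] (P : ι → Matrix n n ℂ) (c : ℝ)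
    (hP : ∀ x y z w, ∑ k, P k x y * (starRingEnd ℂ) (P k z w)
      = if x = z ∧ y = w then (c : ℂ) else 0)
    (ρ : Matrix n n ℂ) :
    ∑ k, Complex.normSq ((P k * ρ).trace) = c * ∑ a, ∑ b, Complex.normSq (ρ a b) := by
  have : ((∑ k, Complex.normSq ((P k * ρ).trace) : ℝ) : ℂ)
      = ((c * ∑ a, ∑ b, Complex.normSq (ρ a b) : ℝ) : ℂ) := by
    push_cast
    simp only [← Complex.mul_conj]
    have e : ∀ k, (P k * ρ).trace = ∑ q : n × n, P k q.1 q.2 * ρ q.2 q.1 := by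
      intro k
      rw [Fintype.sum_prod_type]
      simp [Matrix.trace, Matrix.mul_apply]
    simp only [e, map_sum, map_mul, Finset.sum_mul_sum]
    rw [Finset.sum_comm]
    have : ∀ q : n × n, ∑ k, ∑ r : n × n, P k q.1 q.2 * ρ q.2 q.1 *
        ((starRingEnd ℂ) (P k r.1 r.2) * (starRingEnd ℂ) (ρ r.2 r.1))
        = c * (ρ q.2 q.1 * (starRingEnd ℂ) (ρ q.2 q.1)) := by
      intro q
      rw [Finset.sum_comm]
      have : ∀ r : n × n, ∑ k, P k q.1 q.2 * ρ q.2 q.1 *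
        ((starRingEnd ℂ) (P k r.1 r.2) * (starRingEnd ℂ) (ρ r.2 r.1))
        = if q = r then c * (ρ q.2 q.1 * (starRingEnd ℂ) (ρ q.2 q.1)) else 0 := by
        intro r
        have h := hP q.1 q.2 r.1 r.2
        calc _ = (∑ k, P k q.1 q.2 * (starRingEnd ℂ) (P k r.1 r.2)) *
              (ρ q.2 q.1 * (starRingEnd ℂ) (ρ r.2 r.1)) := by
              rw [Finset.sum_mul]
              exact Finset.sum_congr rfl fun k _ => by ring
          _ = _ := by
              rw [h]
              by_cases hq : q = r
              · subst hq
                simp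
              · rw [if_neg hq, if_neg fun h' => hq (Prod.ext h'.1 h'.2), zero_mul]
      simp [this]
    rw [Finset.sum_congr rfl fun q _ => this q, ← Finset.mul_sum, Fintype.sum_prod_type,
      Finset.sum_comm]
  exact_mod_cast this

lemma purity {n : Type*} [Fintype n] [DecidableEq n] {ρ : Matrix n n ℂ} (h : ρ.PosSemidef)
    (ht : ρ.trace = 1) : ∑ a, ∑ b, Complex.normSq (ρ a b) ≤ 1 := by
  have h1 : ∑ a, (ρ a a).re = 1 := by
    have := congrArg Complex.re ht
    simpa [Matrix.trace] using this
  calc _ ≤ ∑ a, ∑ b, (ρ a a).re * (ρ b b).re :=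
        Finset.sum_le_sum fun a _ => Finset.sum_le_sum fun b _ => minor_le h a b
    _ = 1 := by rw [← Finset.sum_mul_sum, h1, one_mul]

lemma pauli_orth (x y z w : Fin 2) : ∑ k, pauli k x y * (starRingEnd ℂ) (pauli k z w)
      = if x = z ∧ y = w then ((2 : ℝ) : ℂ) else 0 := by
  fin_cases x <;> fin_cases y <;> fin_cases z <;> fin_cases w <;>
    simp [Fin.sum_univ_four, pauli] <;> norm_num

lemma pWord_orth {n : ℕ} (x y z w : Fin n → Fin 2) :
    ∑ k, pWord k x y * (starRingEnd ℂ) (pWord k z w)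
      = if x = z ∧ y = w then ((2 ^ n : ℝ) : ℂ) else 0 := by
  simp only [pWord, Matrix.of_apply, map_prod, ← Finset.prod_mul_distrib]
  rw [← Fintype.piFinset_univ, ← Finset.prod_univ_sum (fun _ => Finset.univ)
    (fun i k => pauli k (x i) (y i) * (starRingEnd ℂ) (pauli k (z i) (w i)))]
  simp only [pauli_orth]
  split_ifs with h
  · obtain ⟨rfl, rfl⟩ := h
    simp
  · have : ∃ i, ¬ (x i = z i ∧ y i = w i) := by
      by_contra! hh
      exact h ⟨funext fun i => (hh i).1, funext fun i => (hh i).2⟩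
    obtain ⟨i, hi⟩ := this
    exact Finset.prod_eq_zero (Finset.mem_univ i) (if_neg hi)

lemma A1_le {A : Matrix (Fin 2) (Fin 2) ℂ} (h : A.PosSemidef) (ht : A.trace = 1) :
    ∑ k ∈ Finset.univ.filter (fun k : Fin 4 => k ≠ 0),
      Complex.normSq ((pauli k * A).trace) ≤ 1 := by
  have h1 := parseval pauli 2 pauli_orth A
  have h2 := purity h ht
  rw [← Finset.sum_filter_add_sum_filter_not _ (fun k : Fin 4 => k ≠ 0)] at h1
  have : ∑ k ∈ Finset.univ.filter (fun k : Fin 4 => ¬ k ≠ 0),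
      Complex.normSq ((pauli k * A).trace) = 1 := by
    simp [Finset.filter_eq', pauli, ht]
  linarith

lemma pWord_zero {n : ℕ} : pWord (fun _ : Fin n => 0) = 1 := by
  ext x y
  simp only [pWord, pauli, Matrix.of_apply, Matrix.one_apply, Finset.prod_ite_zero]
  simp [funext_iff]

lemma A2_le {B : Matrix (Fin 2 → Fin 2) (Fin 2 → Fin 2) ℂ} (h : B.PosSemidef)
    (ht : B.trace = 1) :
    ∑ k ∈ Finset.univ.filter (fun k : Fin 2 → Fin 4 => ∀ i, k i ≠ 0),
      Complex.normSq ((pWord k * B).trace) ≤ 3 := by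
  have h1 := parseval pWord (2 ^ 2) pWord_orth B
  have h2 := purity h ht
  have h3 : ∑ k ∈ insert (fun _ => 0) (Finset.univ.filter (fun k : Fin 2 → Fin 4 => ∀ i, k i ≠ 0)),
      Complex.normSq ((pWord k * B).trace) ≤ ∑ k, Complex.normSq ((pWord k * B).trace) :=
    Finset.sum_le_sum_of_subset_of_nonneg (Finset.subset_univ _)
      fun _ _ _ => Complex.normSq_nonneg _
  rw [Finset.sum_insert (by simp), pWord_zero, one_mul, ht, map_one] at h3
  linarith

lemma wt_three (w : Fin 3 → Fin 4) : wt w = 3 ↔ ∀ i, w i ≠ 0 := by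
  unfold wt
  have := Finset.card_filter_eq_iff (s := (Finset.univ : Finset (Fin 3))) (p := fun i => w i ≠ 0)
  simpa using this

lemma trace_emb3 (j : Fin 3) (A : Matrix (Fin 2) (Fin 2) ℂ)
    (B : Matrix (Fin 2 → Fin 2) (Fin 2 → Fin 2) ℂ) (w : Fin 3 → Fin 4) :
    (pWord w * emb3 j A B).trace =
      (pauli (w j) * A).trace * (pWord (fun t => w (j.succAbove t)) * B).trace := by
  simp only [Matrix.trace, Matrix.diag_apply, Matrix.mul_apply]
  rw [Finset.sum_mul_sum, ← (Fin.insertNthEquiv (fun _ => Fin 2) j).sum_comp,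
    Fintype.sum_prod_type]
  refine Finset.sum_congr rfl fun p _ => Finset.sum_congr rfl fun p' _ => ?_
  rw [Finset.sum_mul_sum, ← (Fin.insertNthEquiv (fun _ => Fin 2) j).sum_comp,
    Fintype.sum_prod_type]
  refine Finset.sum_congr rfl fun q _ => Finset.sum_congr rfl fun q' _ => ?_
  simp only [pWord, emb3, Matrix.of_apply, Fin.prod_univ_succAbove _ j, Fin.insertNthEquiv_apply,
    Fin.insertNth_apply_same, Fin.insertNth_apply_succAbove]
  ring

lemma sum_prod_aux {α β : Type*} [Fintype α] [Fintype β] (f : α → ℝ) (g : β → ℝ) :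
    ∑ p : α × β, f p.1 * g p.2 = (∑ a, f a) * ∑ b, g b := by
  rw [Fintype.sum_prod_type, Finset.sum_mul_sum]

lemma emb3_le (j : Fin 3) {A : Matrix (Fin 2) (Fin 2) ℂ}
    {B : Matrix (Fin 2 → Fin 2) (Fin 2 → Fin 2) ℂ} (hA : A.PosSemidef) (tA : A.trace = 1)
    (hB : B.PosSemidef) (tB : B.trace = 1) : sector 3 3 (emb3 j A B) ≤ 3 := by
  unfold sector
  have key : ∀ w : Fin 3 → Fin 4, ((pWord w * emb3 j A B).trace.re) ^ 2 ≤
      Complex.normSq ((pauli (w j) * A).trace) *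
      Complex.normSq ((pWord (fun t => w (j.succAbove t)) * B).trace) := by
    intro w
    rw [trace_emb3, ← Complex.normSq_mul, Complex.normSq_apply]
    nlinarith [mul_self_nonneg (((pauli (w j) * A).trace *
      (pWord (fun t => w (j.succAbove t)) * B).trace).im)]
  refine (Finset.sum_le_sum fun w _ => key w).trans ?_
  simp only [wt_three]
  rw [Finset.sum_filter, ← (Fin.insertNthEquiv (fun _ => Fin 4) j).sum_comp]
  have e : ∀ p : Fin 4 × (Fin 2 → Fin 4),
      (if ∀ i, (Fin.insertNthEquiv (fun _ => Fin 4) j) p i ≠ 0 then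
        Complex.normSq ((pauli ((Fin.insertNthEquiv (fun _ => Fin 4) j) p j) * A).trace) *
        Complex.normSq ((pWord (fun t => (Fin.insertNthEquiv (fun _ => Fin 4) j) p
          (j.succAbove t)) * B).trace) else 0)
      = (if p.1 ≠ 0 then Complex.normSq ((pauli p.1 * A).trace) else 0) *
        (if ∀ i, p.2 i ≠ 0 then Complex.normSq ((pWord p.2 * B).trace) else 0) := by
    intro p
    simp only [Fin.forall_iff_succAbove j, Fin.insertNthEquiv_apply,
      Fin.insertNth_apply_same, Fin.insertNth_apply_succAbove]
    split_ifs <;> simp_all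
  rw [Finset.sum_congr rfl fun p _ => e p]
  have h1 := A1_le hA tA
  have h2 := A2_le hB tB
  rw [Finset.sum_filter] at h1 h2
  refine (sum_prod_aux
    (fun k : Fin 4 => if k ≠ 0 then Complex.normSq ((pauli k * A).trace) else 0)
    (fun v : Fin 2 → Fin 4 =>
      if ∀ i, v i ≠ 0 then Complex.normSq ((pWord v * B).trace) else 0)).le.trans ?_
  calc _ ≤ (1 : ℝ) * 3 := mul_le_mul h1 h2
        (Finset.sum_nonneg fun _ _ => by
          split_ifs
          exacts [Complex.normSq_nonneg _, le_rfl]) zero_le_one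
    _ = 3 := one_mul _

lemma bisep_le {ρ : Matrix (Fin 3 → Fin 2) (Fin 3 → Fin 2) ℂ} (h : Biseparable3 ρ) :
    sector 3 3 ρ ≤ 3 := by
  obtain ⟨m, p, j, a, b, hp, hs, ha, hb, rfl⟩ := h
  have key : sector 3 3 (∑ i, (p i : ℂ) • emb3 (j i) (a i) (b i))
      ≤ ∑ i, p i * sector 3 3 (emb3 (j i) (a i) (b i)) := by
    unfold sector
    simp only [Finset.mul_sum]
    rw [Finset.sum_comm]
    refine Finset.sum_le_sum fun w _ => ?_
    have := (even_two.convexOn_pow (𝕜 := ℝ)).map_sum_le (t := Finset.univ) (w := p)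
      (p := fun i => (pWord w * emb3 (j i) (a i) (b i)).trace.re)
      (fun i _ => hp i) hs (fun _ _ => Set.mem_univ _)
    simpa [Matrix.trace_sum, Matrix.mul_sum] using this
  refine key.trans ?_
  calc _ ≤ ∑ i, p i * 3 := Finset.sum_le_sum fun i _ =>
        mul_le_mul_of_nonneg_left
          (emb3_le (j i) (ha i).1 (ha i).2 (hb i).1 (hb i).2) (hp i)
    _ = 3 := by rw [← Finset.sum_mul, hs, one_mul]

lemma ghz_trace (w : Fin 3 → Fin 4) : (pWord w * outer ghzVec).trace =
    (1 / 2) * (pWord w (fun _ => 0) (fun _ => 0) + pWord w (fun _ => 0) (fun _ => 1)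
      + pWord w (fun _ => 1) (fun _ => 0) + pWord w (fun _ => 1) (fun _ => 1)) := by
  have hne : (fun _ : Fin 3 => (1 : Fin 2)) ≠ fun _ => 0 := fun h => by
    simpa using congrFun h 0
  have hg : ∀ x, ghzVec x = (Real.sqrt 2 : ℂ)⁻¹ *
      ((if x = (fun _ => 0) then 1 else 0) + (if x = (fun _ => 1) then 1 else 0)) := by
    intro x
    unfold ghzVec
    split_ifs with h1 h2 <;> simp_all
  have hs : (Real.sqrt 2 : ℂ)⁻¹ * (Real.sqrt 2 : ℂ)⁻¹ = 1 / 2 := by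
    rw [← mul_inv, ← Complex.ofReal_mul, Real.mul_self_sqrt (by norm_num)]
    norm_num
  have : ∀ x y, outer ghzVec x y = 1 / 2 *
      (((if x = (fun _ => 0) then 1 else 0) + (if x = (fun _ => 1) then 1 else 0)) *
      ((if y = (fun _ => 0) then 1 else 0) + (if y = (fun _ => 1) then 1 else 0))) := by
    intro x y
    rw [outer, Matrix.of_apply, hg, hg, ← hs]
    simp only [map_mul, map_inv₀, Complex.conj_ofReal, map_add, apply_ite (starRingEnd ℂ),
      map_one, map_zero]
    ring
  simp only [Matrix.trace, Matrix.diag_apply, Matrix.mul_apply, this]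
  simp only [mul_add, Finset.sum_add_distrib, mul_ite, mul_one, mul_zero,
    Finset.sum_ite_eq', Finset.mem_univ, if_true,
    Finset.sum_ite_irrel, Finset.sum_const_zero]
  ring

lemma sum_words (f : (Fin 3 → Fin 4) → ℝ) : ∑ w, f w = ∑ a, ∑ b, ∑ c, f ![a, b, c] := by
  rw [← (Fin.consEquiv (fun _ => Fin 4)).sum_comp, Fintype.sum_prod_type]
  refine Finset.sum_congr rfl fun a _ => ?_
  rw [← (finTwoArrowEquiv (Fin 4)).symm.sum_comp, Fintype.sum_prod_type]
  rfl

lemma ghz_sector : sector 3 3 (outer ghzVec) = 4 := by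
  unfold sector
  simp only [wt_three, ghz_trace]
  rw [Finset.sum_filter, sum_words]
  simp [Fin.sum_univ_four, Fin.forall_fin_succ, pWord, Fin.prod_univ_three, pauli]
  norm_num

/-- Every biseparable three-qubit state satisfies `A₃(ρ) ≤ 3`; the GHZ state
has `A₃ = 4`, so three-qubit states with `A₃ > 3` are genuinely multipartite entangled. -/
theorem biseparable_A3_le_three :
    (∀ ρ : Matrix (Fin 3 → Fin 2) (Fin 3 → Fin 2) ℂ,
      IsState ρ → Biseparable3 ρ → sector 3 3 ρ ≤ 3) ∧
    sector 3 3 (outer ghzVec) = 4 ∧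
    (∀ ρ : Matrix (Fin 3 → Fin 2) (Fin 3 → Fin 2) ℂ,
      IsState ρ → 3 < sector 3 3 ρ → ¬ Biseparable3 ρ) := by
  exact ⟨fun ρ _ h => bisep_le h, ghz_sector, fun ρ _ h hb => absurd (bisep_le hb) (not_le.mpr h)⟩
end
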